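/- arXiv:2402.17839 — 2 statements merged into one kernel-verified Lean document; each statement's English description precedes it below -/
import Mathlib

section
/- Let F be a field of characteristic zero and k ≥ 2. For each i ∈ Fin k, the ideal L_i = (X(i,0), X(i,1), …, X(i,k)) of MvPolynomial (Fin k × Fin (k+1)) F generated by the variables of the i-th row is a minimal prime over the maximal permanental ideal I_{k,k+1}, i.e., L_i ∈ I_{k,k+1}.minimalPrimes. In particular, P_{k,k+1} has at least k linear spaces of codimension k+1 among its irreducible components. -/
open MvPolynomial

noncomputable section

/-- The permanent of a square matrix. -/
def perm {R : Type*} [CommRing R] {m : ℕ} (A : Matrix (Fin m) (Fin m) R) : R :=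
  ∑ σ : Equiv.Perm (Fin m), ∏ i, A i (σ i)

/-- The maximal permanental ideal `I_{k,k+1}`: the ideal generated by the `k + 1`
permanents `perm_j(M)` of the `k × k` submatrices of the generic `k × (k+1)` matrix
obtained by deleting one column `j`. -/
def permanentalIdeal (F : Type*) [Field F] (k : ℕ) :
    Ideal (MvPolynomial (Fin k × Fin (k + 1)) F) :=
  Ideal.span (Set.range fun j : Fin (k + 1) =>
    perm (Matrix.of fun i i' : Fin k => X (i, j.succAbove i')))

/-- The coefficient of `X (i, l)` in the expansion along the row `i` of the permanent obtained by
deleting the column `j`. -/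
def rowCofactor (F : Type*) [Field F] {k : ℕ} (i : Fin k) :
    Matrix (Fin (k + 1)) (Fin (k + 1)) (MvPolynomial (Fin k × Fin (k + 1)) F) :=
  Matrix.of fun j l => ∑ σ : Equiv.Perm (Fin k) with j.succAbove (σ i) = l,
    ∏ r ∈ Finset.univ.erase i, X (r, j.succAbove (σ r))

theorem rowCofactor_mulVec (F : Type*) [Field F] {k : ℕ} (i : Fin k) (j : Fin (k + 1)) :
    (rowCofactor F i).mulVec (fun l => X (i, l)) j =
      perm (Matrix.of fun i i' : Fin k =>
        (X (i, j.succAbove i') : MvPolynomial (Fin k × Fin (k + 1)) F)) := by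
  simp only [Matrix.mulVec, dotProduct, rowCofactor, perm, Matrix.of_apply, Finset.sum_mul]
  rw [← Finset.sum_fiberwise (s := Finset.univ)
    (g := fun σ : Equiv.Perm (Fin k) => j.succAbove (σ i))]
  refine Finset.sum_congr rfl fun l _ => Finset.sum_congr rfl fun σ hσ => ?_
  rw [← (Finset.mem_filter.mp hσ).2, Finset.prod_erase_mul _ _ (Finset.mem_univ i)]

theorem card_perm_apply_eq {α : Type*} [Fintype α] [DecidableEq α] (a b : α) :
    (Finset.univ.filter fun σ : Equiv.Perm α => σ a = b).card =
      (Finset.univ.filter fun σ : Equiv.Perm α => σ a = a).card := by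
  refine Finset.card_equiv (Equiv.mulLeft (Equiv.swap a b)) fun σ => ?_
  simp [Equiv.swap_apply_eq_iff]

/-- The point of affine space whose `i`-th row is zero and whose other entries are one. -/
def zeroRowPoint (F : Type*) [Field F] {k : ℕ} (i : Fin k) : Fin k × Fin (k + 1) → F :=
  fun p => if p.1 = i then 0 else 1

theorem eval_rowCofactor (F : Type*) [Field F] {k : ℕ} (i : Fin k) :
    (eval (zeroRowPoint F i)).mapMatrix (rowCofactor F i) =
      ((Finset.univ.filter fun σ : Equiv.Perm (Fin k) => σ i = i).card : F) •
        (Matrix.of (fun _ _ => 1) - 1) := by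
  ext j l
  have hprod (σ : Equiv.Perm (Fin k)) : ∏ r ∈ Finset.univ.erase i,
      zeroRowPoint F i (r, j.succAbove (σ r)) = 1 :=
    Finset.prod_eq_one fun r hr => by simp [zeroRowPoint, Finset.ne_of_mem_erase hr]
  simp only [rowCofactor, RingHom.mapMatrix_apply, Matrix.map_apply, Matrix.of_apply, map_sum,
    map_prod, eval_X, hprod, Matrix.smul_apply, Matrix.sub_apply, Finset.sum_const,
    nsmul_eq_mul, mul_one, smul_eq_mul]
  obtain rfl | ⟨m, rfl⟩ := Fin.eq_self_or_eq_succAbove j l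
  · simp [Fin.succAbove_ne]
  · simp [card_perm_apply_eq i m,
      Matrix.one_apply_ne (Fin.succAbove_ne j m).symm]

theorem det_ones_sub_one_ne_zero (F : Type*) [Field F] [CharZero F] {k : ℕ} (hk : k ≠ 0) :
    (Matrix.of (fun _ _ => 1) - 1 : Matrix (Fin (k + 1)) (Fin (k + 1)) F).det ≠ 0 := by
  have h : (Matrix.of (fun _ _ => 1) - 1 : Matrix (Fin (k + 1)) (Fin (k + 1)) F) *
      (Matrix.of (fun _ _ => 1) - (k : F) • 1) = (k : F) • 1 := by
    have hJ : (Matrix.of (fun _ _ => 1) : Matrix (Fin (k + 1)) (Fin (k + 1)) F) *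
        Matrix.of (fun _ _ => 1) = ((k : F) + 1) • Matrix.of (fun _ _ => 1) := by
      ext
      simp [Matrix.mul_apply]
    rw [sub_mul, mul_sub, hJ]
    simp only [mul_smul_comm, mul_one, one_mul]
    module
  intro h0
  have h1 := congrArg Matrix.det h
  rw [Matrix.det_mul, h0, zero_mul, Matrix.det_smul, Matrix.det_one, mul_one] at h1
  exact pow_ne_zero _ (Nat.cast_ne_zero.mpr hk) h1.symm

theorem eval_det_rowCofactor_ne_zero (F : Type*) [Field F] [CharZero F] {k : ℕ} (i : Fin k) :
    eval (zeroRowPoint F i) (rowCofactor F i).det ≠ 0 := by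
  rw [RingHom.map_det, eval_rowCofactor, Matrix.det_smul]
  refine mul_ne_zero (pow_ne_zero _ (Nat.cast_ne_zero.mpr ?_))
    (det_ones_sub_one_ne_zero F i.pos.ne')
  exact Finset.card_ne_zero.mpr ⟨1, by simp⟩

theorem isPrime_span_X_image {R σ : Type*} [CommRing R] [IsDomain R] (s : Set σ) :
    (Ideal.span (X '' s : Set (MvPolynomial σ R))).IsPrime := by
  classical
  let φ : MvPolynomial σ R →ₐ[R] MvPolynomial σ R := aeval fun p => if p ∈ s then 0 else X p
  have hφ : (Ideal.Quotient.mkₐ R (Ideal.span (X '' s))).comp φ =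
      Ideal.Quotient.mkₐ R (Ideal.span (X '' s : Set (MvPolynomial σ R))) := by
    ext p
    by_cases hp : p ∈ s
    · have hmem : (X p : MvPolynomial σ R) ∈ Ideal.span (X '' s) :=
        Ideal.subset_span ⟨p, hp, rfl⟩
      simp [φ, hp, Ideal.Quotient.eq_zero_iff_mem.mpr hmem]
    · simp [φ, hp]
  have hker : Ideal.span (X '' s : Set (MvPolynomial σ R)) = RingHom.ker φ := by
    refine le_antisymm (Ideal.span_le.mpr ?_) fun f hf => ?_
    · rintro _ ⟨p, hp, rfl⟩
      simp [RingHom.mem_ker, φ, hp]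
    · refine Ideal.Quotient.eq_zero_iff_mem.mp ((DFunLike.congr_fun hφ f).symm.trans ?_)
      simp [RingHom.mem_ker.mp hf]
  rw [hker]
  exact RingHom.ker_isPrime φ

theorem det_mul_mem_of_mulVec_mem {R n : Type*} [CommRing R] [Fintype n] [DecidableEq n]
    (P : Ideal R) (A : Matrix n n R) (x : n → R) (h : ∀ j, A.mulVec x j ∈ P) (l : n) :
    A.det * x l ∈ P := by
  have hadj : A.adjugate.mulVec (A.mulVec x) l = A.det * x l := by
    rw [Matrix.mulVec_mulVec, Matrix.adjugate_mul, Matrix.smul_mulVec, Matrix.one_mulVec]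
    rfl
  rw [← hadj]
  exact sum_mem fun j _ => P.mul_mem_left _ (h j)

/-- For a field `F` of characteristic zero and `k ≥ 2`, the ideal
`L_i = (X(i,0), …, X(i,k))` generated by the variables of the `i`-th row is a minimal
prime over `I_{k,k+1}`; in particular `P_{k,k+1}` has at least `k` linear spaces of
codimension `k + 1` among its irreducible components. -/
theorem statement8 (F : Type*) [Field F] [CharZero F] (k : ℕ) (hk : 2 ≤ k) (i : Fin k) :
    Ideal.span (Set.range fun j : Fin (k + 1) =>
        (X (i, j) : MvPolynomial (Fin k × Fin (k + 1)) F))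
      ∈ (permanentalIdeal F k).minimalPrimes := by
  refine ⟨⟨?_, ?_⟩, ?_⟩
  · have himage : (Set.range fun j : Fin (k + 1) =>
        (X (i, j) : MvPolynomial (Fin k × Fin (k + 1)) F)) =
        X '' (Set.range fun j : Fin (k + 1) => (i, j)) := by
      rw [← Set.range_comp]
      rfl
    rw [himage]
    exact isPrime_span_X_image _
  · refine Ideal.span_le.mpr ?_
    rintro _ ⟨j, rfl⟩
    simp only [SetLike.mem_coe, ← rowCofactor_mulVec F i j]
    rw [Matrix.mulVec, dotProduct]
    exact sum_mem fun l _ => Ideal.mul_mem_left _ _ (Ideal.subset_span ⟨l, rfl⟩)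
  · rintro P ⟨hP, hIP⟩ hPL
    have hdet : (rowCofactor F i).det ∉ P := by
      intro hmem
      refine eval_det_rowCofactor_ne_zero F i ?_
      have hle : Ideal.span (Set.range fun j : Fin (k + 1) =>
          (X (i, j) : MvPolynomial (Fin k × Fin (k + 1)) F)) ≤
          RingHom.ker (eval (zeroRowPoint F i)) := by
        refine Ideal.span_le.mpr ?_
        rintro _ ⟨j, rfl⟩
        simp [RingHom.mem_ker, zeroRowPoint]
      exact hle (hPL hmem)
    refine Ideal.span_le.mpr ?_
    rintro _ ⟨l, rfl⟩
    refine (hP.mem_or_mem (det_mul_mem_of_mulVec_mem P (rowCofactor F i)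
      (fun l => X (i, l)) (fun j => ?_) l)).resolve_left hdet
    rw [rowCofactor_mulVec]
    exact hIP (Ideal.subset_span ⟨j, rfl⟩)

end
end

section
/- Let F be a field of characteristic zero, k ≥ 3, and let M be the generic k×(k+1) matrix over F. For ℓ ∈ Fin k and i, j ∈ Fin (k+1), let M_{ℓ,i,j} be the permanent of the (k−1)×(k−1) submatrix of M obtained by omitting row ℓ and columns i and j if i ≠ j, and 0 if i = j. For j ∈ Fin (k+1), let C_j be the k×k matrix (M_{ℓ,i,j}) with ℓ ∈ Fin k and i ranging over Fin(k+1) \ {j}; for ℓ ∈ Fin k, let B_ℓ be the symmetric (k+1)×(k+1) matrix (M_{ℓ,i,j})_{i,j}. Then det(C_j) and det(B_ℓ) belong to the nondegenerate permanental ideal J_k = I_{k,k+1} : (Π_{i,j} X(i,j))^∞; i.e., there exists m ∈ ℕ such that (Π_{i,j} X(i,j))^m · det(C_j) ∈ I_{k,k+1}, and similarly for det(B_ℓ). -/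
open MvPolynomial

noncomputable section

/-- The strictly monotone enumeration of `Fin m` with the element `a` omitted. -/
def skip1 {m : ℕ} (a : Fin m) (t : Fin (m - 1)) : Fin m :=
  if h : t.val < a.val then ⟨t.val, h.trans a.isLt⟩
  else ⟨t.val + 1, by have := t.isLt; omega⟩

/-- The strictly monotone enumeration of `Fin m` with the two (distinct) elements
`i` and `j` omitted. -/
def skip2 {m : ℕ} (i j : Fin m) (t : Fin (m - 2)) : Fin m :=
  if h1 : t.val < min i.val j.val then ⟨t.val, by have := i.isLt; omega⟩
  else if h2 : t.val + 1 < max i.val j.val then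
    ⟨t.val + 1, by have := i.isLt; have := j.isLt; omega⟩
  else ⟨t.val + 2, by have := t.isLt; omega⟩

/-- `M_{ℓ,i,j}`: the permanent of the `(k-1) × (k-1)` submatrix of the generic
`k × (k+1)` matrix obtained by omitting row `ℓ` and columns `i` and `j` (and `0`
when `i = j`). -/
def Mlij (F : Type*) [Field F] (k : ℕ) (ℓ : Fin k) (i j : Fin (k + 1)) :
    MvPolynomial (Fin k × Fin (k + 1)) F :=
  if i = j then 0
  else perm (Matrix.of fun (r c : Fin (k - 1)) => X (skip1 ℓ r, skip2 i j c))

/-- The `k × k` matrix `C_j = (M_{ℓ,i,j})` with `ℓ ∈ Fin k` and `i` ranging over the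
columns different from `j`. -/
def Cmat (F : Type*) [Field F] (k : ℕ) (j : Fin (k + 1)) :
    Matrix (Fin k) (Fin k) (MvPolynomial (Fin k × Fin (k + 1)) F) :=
  Matrix.of fun ℓ i' => Mlij F k ℓ (j.succAbove i') j

/-- The symmetric `(k+1) × (k+1)` matrix `B_ℓ = (M_{ℓ,i,j})_{i,j}`. -/
def Bmat (F : Type*) [Field F] (k : ℕ) (ℓ : Fin k) :
    Matrix (Fin (k + 1)) (Fin (k + 1)) (MvPolynomial (Fin k × Fin (k + 1)) F) :=
  Matrix.of fun i j => Mlij F k ℓ i j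

theorem perm_transpose {R : Type*} [CommRing R] {m : ℕ} (A : Matrix (Fin m) (Fin m) R) :
    perm A.transpose = perm A := by
  unfold perm
  refine Fintype.sum_equiv (Equiv.inv (Equiv.Perm (Fin m))) _ _ fun σ => ?_
  refine Fintype.prod_equiv σ _ _ fun i => ?_
  simp

/-- The permutation sending `r` to `c` and acting as `e` between the complements. -/
def permInsert {n : ℕ} (r c : Fin (n + 1)) (e : Equiv.Perm (Fin n)) :
    Equiv.Perm (Fin (n + 1)) :=
  ((finSuccEquiv' r).trans (Equiv.optionCongr e)).trans (finSuccEquiv' c).symm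

theorem permInsert_self {n : ℕ} (r c : Fin (n + 1)) (e : Equiv.Perm (Fin n)) :
    permInsert r c e r = c := by
  simp [permInsert]

theorem permInsert_succAbove {n : ℕ} (r c : Fin (n + 1)) (e : Equiv.Perm (Fin n)) (i : Fin n) :
    permInsert r c e (r.succAbove i) = c.succAbove (e i) := by
  simp [permInsert]

theorem permInsert_bijective {n : ℕ} (r : Fin (n + 1)) :
    Function.Bijective fun p : Fin (n + 1) × Equiv.Perm (Fin n) => permInsert r p.1 p.2 := by
  rw [Fintype.bijective_iff_injective_and_card]
  constructor
  · rintro ⟨c, e⟩ ⟨c', e'⟩ h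
    have hc : c = c' := by
      simpa [permInsert_self] using congrArg (fun σ : Equiv.Perm (Fin (n + 1)) => σ r) h
    subst hc
    congr 1
    ext i : 1
    simpa [permInsert_succAbove] using
      congrArg (fun σ : Equiv.Perm (Fin (n + 1)) => σ (r.succAbove i)) h
  · simp [Fintype.card_perm, Nat.factorial_succ]

/-- Laplace expansion of the permanent along a row. -/
theorem perm_succ_row {R : Type*} [CommRing R] {n : ℕ}
    (A : Matrix (Fin (n + 1)) (Fin (n + 1)) R) (r : Fin (n + 1)) :
    perm A = ∑ c, A r c * perm (A.submatrix r.succAbove c.succAbove) := by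
  unfold perm
  rw [← (permInsert_bijective r).sum_comp, Fintype.sum_prod_type]
  refine Finset.sum_congr rfl fun c _ => ?_
  rw [Finset.mul_sum]
  refine Finset.sum_congr rfl fun e _ => ?_
  rw [Fin.prod_univ_succAbove _ r]
  simp [permInsert_self, permInsert_succAbove]

/-- Laplace expansion of the permanent along a column. -/
theorem perm_succ_column {R : Type*} [CommRing R] {n : ℕ}
    (A : Matrix (Fin (n + 1)) (Fin (n + 1)) R) (c : Fin (n + 1)) :
    perm A = ∑ r, A r c * perm (A.submatrix r.succAbove c.succAbove) := by
  rw [← perm_transpose, perm_succ_row _ c]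
  refine Finset.sum_congr rfl fun r _ => ?_
  rw [← perm_transpose (A.submatrix _ _)]
  rfl

theorem skip1_eq_succAbove {n : ℕ} (a : Fin (n + 1)) (t : Fin n) :
    skip1 a t = a.succAbove t := by
  ext
  simp only [skip1, Fin.succAbove, Fin.lt_def, Fin.val_castSucc]
  split_ifs <;> simp

theorem skip2_succAbove {n : ℕ} (j : Fin (n + 2)) (c : Fin (n + 1)) (t : Fin n) :
    skip2 (j.succAbove c) j t = j.succAbove (c.succAbove t) := by
  have h (m : ℕ) (p : Fin (m + 1)) (q : Fin m) :
      (p.succAbove q).val = if q.val < p.val then q.val else q.val + 1 := by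
    rw [Fin.succAbove, apply_ite Fin.val]
    rfl
  ext
  simp only [skip2, apply_dite Fin.val, h]
  split_ifs <;> omega

theorem skip2_comm {m : ℕ} (i j : Fin m) : skip2 i j = skip2 j i := by
  funext t
  simp only [skip2, min_comm, max_comm]

theorem Mlij_comm (F : Type*) [Field F] (k : ℕ) (ℓ : Fin k) (i j : Fin (k + 1)) :
    Mlij F k ℓ i j = Mlij F k ℓ j i := by
  simp only [Mlij, skip2_comm i j, eq_comm]

theorem Mlij_self (F : Type*) [Field F] (k : ℕ) (ℓ : Fin k) (i : Fin (k + 1)) :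
    Mlij F k ℓ i i = 0 :=
  if_pos rfl

theorem Mlij_succAbove (F : Type*) [Field F] (n : ℕ) (ℓ : Fin (n + 1)) (j : Fin (n + 2))
    (c : Fin (n + 1)) :
    Mlij F (n + 1) ℓ (j.succAbove c) j =
      perm ((Matrix.of fun i i' : Fin (n + 1) =>
        (X (i, j.succAbove i') : MvPolynomial (Fin (n + 1) × Fin (n + 2)) F)).submatrix
          ℓ.succAbove c.succAbove) := by
  rw [Mlij, if_neg (Fin.succAbove_ne j c)]
  refine congrArg perm ?_
  ext1 r t
  exact congrArg X (Prod.ext (skip1_eq_succAbove ℓ r) (skip2_succAbove j c t))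

theorem sum_row_mul_Mlij (F : Type*) [Field F] (n : ℕ) (ℓ : Fin (n + 1)) (j : Fin (n + 2)) :
    ∑ i, X (ℓ, i) * Mlij F (n + 1) ℓ i j =
      perm (Matrix.of fun i i' : Fin (n + 1) => X (i, j.succAbove i')) := by
  rw [Fin.sum_univ_succAbove _ j, Mlij_self, mul_zero, zero_add, perm_succ_row _ ℓ]
  simp only [Mlij_succAbove, Matrix.of_apply]

theorem sum_column_mul_Mlij (F : Type*) [Field F] (n : ℕ) {i j : Fin (n + 2)} (hij : j ≠ i) :
    ∑ ℓ, X (ℓ, j) * Mlij F (n + 1) ℓ i j =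
      perm (Matrix.of fun r r' : Fin (n + 1) => X (r, i.succAbove r')) := by
  obtain ⟨c, rfl⟩ := Fin.exists_succAbove_eq hij
  rw [perm_succ_column _ c]
  simp only [Mlij_comm F _ _ i, Mlij_succAbove, Matrix.of_apply]

theorem perm_mem_permanentalIdeal (F : Type*) [Field F] (k : ℕ) (j : Fin (k + 1)) :
    perm (Matrix.of fun i i' : Fin k => X (i, j.succAbove i')) ∈ permanentalIdeal F k :=
  Ideal.subset_span ⟨j, rfl⟩

/-- If a row vector lies in the left kernel of `A` modulo `I`, then its entries multiply
`det A` into `I`. -/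
theorem mul_det_mem_of_vecMul_mem {R n : Type*} [CommRing R] [Fintype n] [DecidableEq n]
    (I : Ideal R) (A : Matrix n n R) (v : n → R) (h : ∀ j, (Matrix.vecMul v A) j ∈ I) (i : n) :
    v i * A.det ∈ I := by
  have key : v i * A.det = Matrix.vecMul (Matrix.vecMul v A) A.adjugate i := by
    rw [Matrix.vecMul_vecMul, Matrix.mul_adjugate, Matrix.vecMul_smul, Matrix.vecMul_one]
    simp [mul_comm]
  rw [key]
  exact I.sum_mem fun j _ => I.mul_mem_right _ (h j)

theorem exists_prod_X_pow_mul_mem {σ F : Type*} [Fintype σ] [CommRing F]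
    {I : Ideal (MvPolynomial σ F)} {f : MvPolynomial σ F} (p : σ) (h : X p * f ∈ I) :
    ∃ m : ℕ, (∏ q, (X q : MvPolynomial σ F)) ^ m * f ∈ I := by
  obtain ⟨g, hg⟩ := Finset.dvd_prod_of_mem (X : σ → MvPolynomial σ F) (Finset.mem_univ p)
  refine ⟨1, ?_⟩
  rw [pow_one, hg, mul_comm (X p) g, mul_assoc]
  exact I.mul_mem_left g h

/-- Kirkup's determinants lie in the nondegenerate permanental ideal: for a field `F` of
characteristic zero and `k ≥ 3`, both `det C_j` and `det B_ℓ` belong to the saturation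
`J_k = I_{k,k+1} : (Π_{i,j} X(i,j))^∞`. -/
theorem statement12 (F : Type*) [Field F] [CharZero F] (k : ℕ) (hk : 3 ≤ k) :
    (∀ j : Fin (k + 1), ∃ m : ℕ,
      (∏ p : Fin k × Fin (k + 1), (X p : MvPolynomial (Fin k × Fin (k + 1)) F)) ^ m
        * (Cmat F k j).det ∈ permanentalIdeal F k) ∧
    (∀ ℓ : Fin k, ∃ m : ℕ,
      (∏ p : Fin k × Fin (k + 1), (X p : MvPolynomial (Fin k × Fin (k + 1)) F)) ^ m
        * (Bmat F k ℓ).det ∈ permanentalIdeal F k) := by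
  obtain ⟨n, rfl⟩ : ∃ n, k = n + 1 := ⟨k - 1, by omega⟩
  refine ⟨fun j => exists_prod_X_pow_mul_mem (0, j) ?_,
    fun ℓ => exists_prod_X_pow_mul_mem (ℓ, 0) ?_⟩
  · refine mul_det_mem_of_vecMul_mem _ (Cmat F (n + 1) j) (fun ℓ => X (ℓ, j)) (fun i => ?_) 0
    have h := perm_mem_permanentalIdeal F (n + 1) (j.succAbove i)
    rwa [← sum_column_mul_Mlij F n (Fin.ne_succAbove j i)] at h
  · refine mul_det_mem_of_vecMul_mem _ (Bmat F (n + 1) ℓ) (fun i => X (ℓ, i)) (fun j => ?_) 0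
    have h := perm_mem_permanentalIdeal F (n + 1) j
    rwa [← sum_row_mul_Mlij F n ℓ j] at h

end
end
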